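/- Let n, f, h, b be natural numbers with n ≥ 1, n > 2f, b ≤ f, 1 ≤ h ≤ n, and h + b = n, and let L, μ, σ be reals with 0 < μ ≤ L and 0 ≤ σ < 1/√n. Let k* = sup { (1 + (x − 1)/√(2x − 1))/√x : x ≥ 1 }, assume nμ − (3 + k*) f L > 0, and let r be a real with 0 < r < (nμ − (3 + k*) f L)/((n − 2f)(1 + σ)L + (1 + k*) f L). Define β = (n − 2f)·(μ − r(1 + σ)L)/(1 + r) − b(1 + k_h σ)L, α_h = hσ² + (1 + k_h σ)², and γ = nL²·(h(1 + σ²) + b·α_h). Then β > 0, γ > 0, there exists η > 0 with η < 2β/γ, and for every real η with 0 < η < 2β/γ the convergence rate ρ = 1 − 2βη + γη² satisfies 0 ≤ ρ < 1. -/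

import Mathlib

/-- `k_x = 1 + (x - 1)/√(2x - 1)` for `x ≥ 1`. -/
noncomputable def kfun (x : ℝ) : ℝ := 1 + (x - 1) / Real.sqrt (2 * x - 1)

/-- `k* = sup { k_x / √x : x ≥ 1 }`. -/
noncomputable def kstar : ℝ := sSup {y : ℝ | ∃ x : ℝ, 1 ≤ x ∧ y = kfun x / Real.sqrt x}

theorem kfun_one_le (x : ℝ) (hx : 1 ≤ x) : 1 ≤ kfun x := by
  unfold kfun
  have : 0 ≤ (x - 1) / Real.sqrt (2 * x - 1) :=
    div_nonneg (by linarith) (Real.sqrt_nonneg _)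
  linarith

theorem kfun_ratio_le_two (x : ℝ) (hx : 1 ≤ x) : kfun x / Real.sqrt x ≤ 2 := by
  have hs : 1 ≤ Real.sqrt x := Real.one_le_sqrt.mpr hx
  have hsq : Real.sqrt x * Real.sqrt x = x := Real.mul_self_sqrt (by linarith)
  have h1 : Real.sqrt x ≤ Real.sqrt (2 * x - 1) := Real.sqrt_le_sqrt (by linarith)
  rw [div_le_iff₀ (by linarith)]
  unfold kfun
  have h2 : (x - 1) / Real.sqrt (2 * x - 1) ≤ Real.sqrt x := by
    rw [div_le_iff₀ (by linarith)]
    nlinarith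
  linarith

theorem kfun_ratio_bdd :
    BddAbove {y : ℝ | ∃ x : ℝ, 1 ≤ x ∧ y = kfun x / Real.sqrt x} := by
  refine ⟨2, ?_⟩
  rintro y ⟨x, hx, rfl⟩
  exact kfun_ratio_le_two x hx

theorem kfun_ratio_le_kstar (x : ℝ) (hx : 1 ≤ x) : kfun x / Real.sqrt x ≤ kstar :=
  le_csSup kfun_ratio_bdd ⟨x, hx, rfl⟩

/-- Theorem (convergence rate): under the resilience condition `nμ - (3 + k*) f L > 0`,
with `σ < 1/√n` and a valid deviation ratio `r`, we have `β > 0`, `γ > 0`, there exists a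
step size `0 < η < 2β/γ`, and for every such `η` the rate `ρ = 1 - 2βη + γη²` lies in `[0, 1)`. -/
theorem conv_rate_in_unit_interval
    (n f h b : ℕ) (hn : 1 ≤ n) (hn2f : 2 * f < n) (hbf : b ≤ f)
    (hh1 : 1 ≤ h) (hhn : h ≤ n) (hhb : h + b = n)
    (L μ σ : ℝ) (hμ : 0 < μ) (hμL : μ ≤ L) (hσ0 : 0 ≤ σ) (hσ : σ < 1 / Real.sqrt n)
    (hnum : 0 < (n : ℝ) * μ - (3 + kstar) * f * L)
    (r : ℝ) (hr0 : 0 < r)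
    (hr : r < ((n : ℝ) * μ - (3 + kstar) * f * L) /
      (((n : ℝ) - 2 * f) * (1 + σ) * L + (1 + kstar) * f * L))
    (β αh γ : ℝ)
    (hβ : β = ((n : ℝ) - 2 * f) * (μ - r * (1 + σ) * L) / (1 + r)
            - (b : ℝ) * (1 + kfun h * σ) * L)
    (hα : αh = (h : ℝ) * σ ^ 2 + (1 + kfun h * σ) ^ 2)
    (hγ : γ = (n : ℝ) * L ^ 2 * ((h : ℝ) * (1 + σ ^ 2) + (b : ℝ) * αh)) :
    0 < β ∧ 0 < γ ∧ (∃ η : ℝ, 0 < η ∧ η < 2 * β / γ) ∧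
      ∀ η : ℝ, 0 < η → η < 2 * β / γ →
        0 ≤ 1 - 2 * β * η + γ * η ^ 2 ∧ 1 - 2 * β * η + γ * η ^ 2 < 1 := by
  have hn' : (1 : ℝ) ≤ n := by exact_mod_cast hn
  have hd : 0 < (n : ℝ) - 2 * f := by
    have : (2 * f : ℝ) < n := by exact_mod_cast hn2f
    linarith
  have hbf' : (b : ℝ) ≤ f := by exact_mod_cast hbf
  have hb0 : (0 : ℝ) ≤ b := Nat.cast_nonneg b
  have hf0 : (0 : ℝ) ≤ f := Nat.cast_nonneg f
  have hh1' : (1 : ℝ) ≤ h := by exact_mod_cast hh1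
  have hhn' : (h : ℝ) ≤ n := by exact_mod_cast hhn
  have hhb' : (h : ℝ) + b = n := by exact_mod_cast hhb
  have hL : 0 < L := lt_of_lt_of_le hμ hμL
  have hk1 : 1 ≤ kfun h := kfun_one_le h hh1'
  have hsh : 0 < Real.sqrt h := Real.sqrt_pos.mpr (by linarith)
  have hsn : 0 < Real.sqrt n := Real.sqrt_pos.mpr (by linarith)
  have hkr := kfun_ratio_le_kstar h hh1'
  have hks0 : 0 ≤ kstar := le_trans (div_nonneg (by linarith) hsh.le) hkr
  rw [div_le_iff₀ hsh] at hkr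
  have hσh : Real.sqrt h * σ ≤ 1 := by
    have h1 : Real.sqrt h ≤ Real.sqrt n := Real.sqrt_le_sqrt hhn'
    rw [lt_div_iff₀ hsn] at hσ
    nlinarith
  have hkσ : kfun h * σ ≤ kstar := by
    calc kfun h * σ ≤ kstar * Real.sqrt h * σ := mul_le_mul_of_nonneg_right hkr hσ0
      _ = kstar * (Real.sqrt h * σ) := by ring
      _ ≤ kstar * 1 := mul_le_mul_of_nonneg_left hσh hks0
      _ = kstar := mul_one _
  have hkσ0 : 0 ≤ kfun h * σ := mul_nonneg (by linarith) hσ0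
  have hD : 0 < ((n : ℝ) - 2 * f) * (1 + σ) * L + (1 + kstar) * f * L := by positivity
  rw [lt_div_iff₀ hD] at hr
  have hbk : (b : ℝ) * (1 + kfun h * σ) * L ≤ f * (1 + kstar) * L := by gcongr
  have hbk0 : 0 ≤ (b : ℝ) * (1 + kfun h * σ) * L := by positivity
  have hr1 : 0 < 1 + r := by linarith
  have hβpos : 0 < β := by
    rw [hβ, sub_pos, lt_div_iff₀ hr1]
    have e1 : (b : ℝ) * (1 + kfun h * σ) * L * (1 + r) ≤ f * (1 + kstar) * L * (1 + r) :=
      mul_le_mul_of_nonneg_right hbk hr1.le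
    have e2 : (f : ℝ) * μ ≤ f * L := mul_le_mul_of_nonneg_left hμL hf0
    linarith
  have hα0 : 0 ≤ αh := by rw [hα]; positivity
  have hγge : (n : ℝ) * L ^ 2 * h ≤ γ := by
    rw [hγ]
    apply mul_le_mul_of_nonneg_left _ (by positivity)
    have : 0 ≤ (h : ℝ) * σ ^ 2 := by positivity
    have : 0 ≤ (b : ℝ) * αh := by positivity
    linarith
  have hγpos : 0 < γ := lt_of_lt_of_le (by positivity) hγge
  have hβle : β ≤ ((n : ℝ) - 2 * f) * L := by
    have e : ((n : ℝ) - 2 * f) * (μ - r * (1 + σ) * L) / (1 + r) ≤ ((n : ℝ) - 2 * f) * L := by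
      rw [div_le_iff₀ hr1, mul_assoc _ L (1 + r)]
      apply mul_le_mul_of_nonneg_left _ hd.le
      have : 0 ≤ r * (1 + σ) * L := by positivity
      have : 0 ≤ L * r := by positivity
      linarith
    linarith
  have hβγ : β ^ 2 ≤ γ := by
    refine le_trans ?_ hγge
    calc β ^ 2 ≤ (((n : ℝ) - 2 * f) * L) ^ 2 := by gcongr
      _ = (((n : ℝ) - 2 * f) * ((n : ℝ) - 2 * f)) * L ^ 2 := by ring
      _ ≤ ((n : ℝ) * h) * L ^ 2 := by
        apply mul_le_mul_of_nonneg_right _ (by positivity)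
        apply mul_le_mul <;> linarith
      _ = (n : ℝ) * L ^ 2 * h := by ring
  have hq : 0 < 2 * β / γ := by positivity
  refine ⟨hβpos, hγpos, ⟨2 * β / γ / 2, by linarith, by linarith⟩, ?_⟩
  intro η hη0 hη
  rw [lt_div_iff₀ hγpos] at hη
  constructor
  · have e1 := sq_nonneg (1 - β * η)
    have e2 := mul_nonneg (sub_nonneg.mpr hβγ) (sq_nonneg η)
    linarith
  · have e3 := mul_pos hη0 (sub_pos.mpr hη)
    linarith
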